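/- For every positive irrational real number β there exists a constant C = C(β) > 0 such that for every integer k ≥ 1 one has ∏_{l=1}^{q_k − 1} 1/|sin(π l β)| < C · 3^{q_k}, where q_k denotes the denominator of the k-th convergent of the continued fraction expansion of β. -/

import Mathlib

open Real Filter Finset

/-- The complete quotients of the continued fraction expansion of `x`:
`g 0 = x`, and `g (n+1) = 1 / Int.fract (g n)`. -/
noncomputable def contFracQuot (x : ℝ) : ℕ → ℝ
  | 0 => x
  | n + 1 => (Int.fract (contFracQuot x n))⁻¹

/-- The partial quotients `a n` of the continued fraction expansion of `x`. -/
noncomputable def contFracA (x : ℝ) (n : ℕ) : ℤ := ⌊contFracQuot x n⌋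

/-- The denominators `q n` of the convergents of the continued fraction expansion of `x`,
satisfying `q 0 = 1`, `q 1 = a 1`, and `q (n+2) = a (n+2) * q (n+1) + q n`
(i.e. the recurrence `qₙ = aₙ qₙ₋₁ + qₙ₋₂` with `q₋₁ = 0`, `q₋₂ = 1`). -/
noncomputable def contFracQ (x : ℝ) : ℕ → ℤ
  | 0 => 1
  | 1 => contFracA x 1
  | n + 2 => contFracA x (n + 2) * contFracQ x (n + 1) + contFracQ x n

theorem sin_le_sin_of_add_le_pi {a x : ℝ} (ha : 0 ≤ a) (hax : a ≤ x) (h : a + x ≤ π) :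
    sin a ≤ sin x := by
  have h1 : sin x - sin a = 2 * sin ((x - a) / 2) * cos ((x + a) / 2) := Real.sin_sub_sin x a
  have h2 : 0 ≤ sin ((x - a) / 2) :=
    sin_nonneg_of_nonneg_of_le_pi (by linarith) (by linarith)
  have h3 : 0 ≤ cos ((x + a) / 2) := cos_nonneg_of_mem_Icc ⟨by linarith, by linarith⟩
  have h4 := mul_nonneg h2 h3
  nlinarith

theorem prod_two_mul_sin_pi_mul_div (n : ℕ) :
    ∏ j ∈ Ico 1 (n + 1), (2 * sin (π * j / (n + 1))) = n + 1 := by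
  have hζ : IsPrimitiveRoot (Complex.exp (2 * π * Complex.I / ((n + 1 : ℕ) : ℂ))) (n + 1) :=
    Complex.isPrimitiveRoot_exp (n + 1) n.succ_ne_zero
  have h := congrArg norm hζ.prod_one_sub_pow_eq_order
  rw [norm_prod, ← Nat.cast_add_one, Complex.norm_natCast] at h
  rw [Finset.prod_Ico_eq_prod_range, Nat.add_sub_cancel, ← Nat.cast_add_one]
  refine Eq.trans (Finset.prod_congr rfl fun j hj => ?_) h
  have hj' : (j : ℝ) + 1 ≤ n := by exact_mod_cast Finset.mem_range.mp hj
  have hn : (0 : ℝ) < n + 1 := by positivity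
  have hexp : Complex.exp (2 * π * Complex.I / ((n + 1 : ℕ) : ℂ)) ^ (j + 1)
      = Complex.exp (Complex.I * ((2 * (π * (1 + j : ℕ) / (n + 1 : ℕ)) : ℝ) : ℂ)) := by
    rw [← Complex.exp_nat_mul]
    congr 1
    push_cast
    ring
  rw [hexp, norm_sub_rev, Complex.norm_exp_I_mul_ofReal_sub_one, mul_div_cancel_left₀ _ two_ne_zero,
    Real.norm_of_nonneg]
  refine mul_nonneg two_pos.le (sin_nonneg_of_nonneg_of_le_pi (by positivity) ?_)
  push_cast
  rw [div_le_iff₀ hn]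
  exact mul_le_mul_of_nonneg_left (by linarith) pi_pos.le

/-- A lower bound for `|sin (π x)|` when `x` lies in `[j / q, (j + 1) / q - 1 / q ^ 2]`. -/
noncomputable def sinLowerBound (q j : ℕ) : ℝ :=
  if j + 1 = q then 2 / (q : ℝ) ^ 2
  else if 2 * j + 1 ≤ q then sin (π * j / q) else sin (π * (j + 1 : ℕ) / q)

theorem sinLowerBound_nonneg {q j : ℕ} (hj : j < q) : 0 ≤ sinLowerBound q j := by
  have hq : (0 : ℝ) < q := by exact_mod_cast j.zero_le.trans_lt hj
  have key : ∀ i : ℕ, i ≤ q → 0 ≤ sin (π * i / q) := fun i hi => by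
    refine sin_nonneg_of_nonneg_of_le_pi (by positivity) ?_
    rw [div_le_iff₀ hq]
    exact mul_le_mul_of_nonneg_left (by exact_mod_cast hi) pi_pos.le
  unfold sinLowerBound
  split_ifs
  · positivity
  · exact key j hj.le
  · exact key (j + 1) hj

theorem sinLowerBound_le {q j : ℕ} (hj : j < q) (hq2 : 2 ≤ q) {x : ℝ} (h1 : (j : ℝ) / q ≤ x)
    (h2 : x ≤ (j + 1) / q - 1 / (q : ℝ) ^ 2) : sinLowerBound q j ≤ sin (π * x) := by
  have hq2' : (2 : ℝ) ≤ q := by exact_mod_cast hq2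
  have hq : (0 : ℝ) < q := by linarith
  have hx2 : x ≤ (j + 1) / q := h2.trans (sub_le_self _ (by positivity))
  have hx0 : 0 ≤ x := le_trans (by positivity) h1
  unfold sinLowerBound
  split_ifs with hlast hle
  · have hjq : (j : ℝ) = q - 1 := by
      rw [← hlast]
      push_cast
      ring
    have hone : 1 / (q : ℝ) ^ 2 ≤ 1 - x := by
      rw [hjq, sub_add_cancel, div_self hq.ne'] at h2
      linarith
    have hone' : 1 / (q : ℝ) ^ 2 ≤ 1 / 2 := by
      apply one_div_le_one_div_of_le two_pos
      nlinarith
    have hxq : 1 - x ≤ 1 / 2 := by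
      rw [hjq, div_le_iff₀ hq] at h1
      nlinarith
    rw [← sin_pi_sub]
    calc 2 / (q : ℝ) ^ 2 = 2 / π * (π * (1 / (q : ℝ) ^ 2)) := by field_simp
      _ ≤ sin (π * (1 / (q : ℝ) ^ 2)) := mul_le_sin (by positivity) (by nlinarith [pi_pos])
      _ ≤ sin (π - π * x) := by
        refine sin_le_sin_of_add_le_pi (by positivity) ?_ ?_ <;> nlinarith [pi_pos]
  · have hle' : 2 * (j : ℝ) + 1 ≤ q := by exact_mod_cast hle
    rw [mul_div_assoc]
    have hsum : (j : ℝ) / q + x ≤ 1 := by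
      calc (j : ℝ) / q + x ≤ j / q + (j + 1) / q := by linarith
        _ = (2 * j + 1) / q := by ring
        _ ≤ 1 := (div_le_one hq).mpr hle'
    refine sin_le_sin_of_add_le_pi (by positivity) ?_ ?_ <;> nlinarith [pi_pos]
  · have hle' : (q : ℝ) ≤ 2 * (j : ℝ) + 1 := by exact_mod_cast (not_le.mp hle).le
    have hj' : ((j + 1 : ℕ) : ℝ) / q ≤ 1 := (div_le_one hq).mpr (by exact_mod_cast hj)
    push_cast at hj' ⊢
    rw [mul_div_assoc, ← sin_pi_sub, ← sin_pi_sub (π * x)]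
    have hsum : 1 ≤ x + (j + 1) / q := by
      calc 1 ≤ (2 * (j : ℝ) + 1) / q := (one_le_div hq).mpr hle'
        _ = j / q + (j + 1) / q := by ring
        _ ≤ x + (j + 1) / q := by linarith
    refine sin_le_sin_of_add_le_pi ?_ ?_ ?_ <;> nlinarith [pi_pos]

theorem le_prod_sinLowerBound {q : ℕ} (hq : 2 ≤ q) :
    4 / (q * 2 ^ q) ≤ ∏ j ∈ Ico 1 q, sinLowerBound q j := by
  obtain ⟨n, rfl⟩ : ∃ n, q = n + 1 := ⟨q - 1, by omega⟩
  set m := (n + 2) / 2 with hm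
  set s : ℕ → ℝ := fun j => sin (π * j / (n + 1 : ℕ)) with hs
  have hm1 : 1 ≤ m := by omega
  have hmn : m ≤ n := by omega
  have hn : (0 : ℝ) < n + 1 := by positivity
  have hs0 : ∀ j ∈ Ico 1 (n + 1), 0 ≤ s j := fun j hj => by
    have hj' : (j : ℝ) ≤ n + 1 := by exact_mod_cast (Finset.mem_Ico.mp hj).2.le
    refine sin_nonneg_of_nonneg_of_le_pi (by positivity) ?_
    push_cast
    rw [div_le_iff₀ hn]
    exact mul_le_mul_of_nonneg_left hj' pi_pos.le
  have hprod : 2 ^ n * ∏ j ∈ Ico 1 (n + 1), s j = n + 1 := by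
    rw [← prod_two_mul_sin_pi_mul_div n, Finset.prod_mul_distrib]
    simp [hs]
  have hA : ∏ j ∈ Ico 1 m, sinLowerBound (n + 1) j = ∏ j ∈ Ico 1 m, s j := by
    refine Finset.prod_congr rfl fun j hj => ?_
    have := Finset.mem_Ico.mp hj
    rw [sinLowerBound, if_neg (by omega), if_pos (by omega)]
  have hB : ∏ j ∈ Ico m n, sinLowerBound (n + 1) j = ∏ j ∈ Ico (m + 1) (n + 1), s j := by
    rw [← Finset.prod_Ico_add' s m n 1]
    refine Finset.prod_congr rfl fun j hj => ?_
    have := Finset.mem_Ico.mp hj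
    rw [sinLowerBound, if_neg (by omega), if_neg (by omega)]
  have hsplit : ∏ j ∈ Ico 1 (n + 1), s j
      = (∏ j ∈ Ico 1 m, s j) * (s m * ∏ j ∈ Ico (m + 1) (n + 1), s j) := by
    rw [← Finset.prod_eq_prod_Ico_succ_bot (by omega), Finset.prod_Ico_consecutive _ hm1 (by omega)]
  have hA0 : 0 ≤ ∏ j ∈ Ico 1 m, s j := Finset.prod_nonneg fun j hj => hs0 j (by
    have := Finset.mem_Ico.mp hj
    exact Finset.mem_Ico.mpr (by omega))
  have hB0 : 0 ≤ ∏ j ∈ Ico (m + 1) (n + 1), s j := Finset.prod_nonneg fun j hj => hs0 j (by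
    have := Finset.mem_Ico.mp hj
    exact Finset.mem_Ico.mpr (by omega))
  have hle : ∏ j ∈ Ico 1 (n + 1), s j
      ≤ (∏ j ∈ Ico 1 m, s j) * ∏ j ∈ Ico (m + 1) (n + 1), s j := by
    rw [hsplit]
    exact mul_le_mul_of_nonneg_left (mul_le_of_le_one_left hB0 (sin_le_one _)) hA0
  have hlast : sinLowerBound (n + 1) n = 2 / ((n : ℝ) + 1) ^ 2 := by
    rw [sinLowerBound, if_pos rfl]
    push_cast
    rfl
  rw [Finset.prod_Ico_succ_top (by omega), ← Finset.prod_Ico_consecutive _ hm1 hmn, hA, hB, hlast]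
  refine le_trans (le_of_eq ?_) (mul_le_mul_of_nonneg_right hle (by positivity))
  rw [eq_div_of_mul_eq (by positivity) ((mul_comm _ _).trans hprod)]
  push_cast
  field_simp
  ring

theorem prod_Ico_mul_emod {M : Type*} [CommMonoid M] (f : ℕ → M) {q : ℕ} {p : ℤ}
    (hpq : IsCoprime p (q : ℤ)) :
    ∏ l ∈ Ico 1 q, f ((l * p % q : ℤ).toNat) = ∏ j ∈ Ico 1 q, f j := by
  rcases Nat.eq_zero_or_pos q with rfl | hq
  · simp
  have hq' : (0 : ℤ) < q := by exact_mod_cast hq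
  have hmaps : ∀ l ∈ Ico 1 q, (l * p % q : ℤ).toNat ∈ Ico 1 q := fun l hl => by
    obtain ⟨h1, h2⟩ := Finset.mem_Ico.mp hl
    have hnn := Int.emod_nonneg (l * p) hq'.ne'
    have hlt := Int.emod_lt_of_pos (l * p) hq'
    have hne : (l * p % q : ℤ) ≠ 0 := fun h0 => by
      have := hpq.symm.dvd_of_dvd_mul_right (Int.dvd_of_emod_eq_zero h0)
      have := Nat.le_of_dvd h1 (Int.natCast_dvd_natCast.mp this)
      omega
    exact Finset.mem_Ico.mpr (by omega)
  have hinj : Set.InjOn (fun l : ℕ => (l * p % q : ℤ).toNat) (Ico 1 q) := fun a ha b hb hab => by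
    have ha' := Finset.mem_Ico.mp ha
    have hb' := Finset.mem_Ico.mp hb
    have h1 := Int.emod_nonneg (a * p) hq'.ne'
    have h2 := Int.emod_nonneg (b * p) hq'.ne'
    have hab' : (a * p % q : ℤ) = b * p % q := by
      simp only at hab
      omega
    have hdvd : (q : ℤ) ∣ (b - a) * p := by
      rw [sub_mul]
      exact (show a * p ≡ b * p [ZMOD q] from hab').dvd
    have := hpq.symm.dvd_of_dvd_mul_right hdvd
    have := Int.eq_zero_of_abs_lt_dvd this (abs_lt.mpr ⟨by omega, by omega⟩)
    omega
  exact Finset.prod_nbij _ hmaps hinj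
    (Finset.surjOn_of_injOn_of_card_le _ hmaps hinj le_rfl) fun _ _ => rfl

theorem le_prod_abs_sin_of_nonneg {β : ℝ} {q : ℕ} {p : ℤ} (hq : 2 ≤ q)
    (hpq : IsCoprime p (q : ℤ)) (h0 : 0 ≤ β - p / q) (h1 : β - p / q ≤ 1 / (q : ℝ) ^ 2) :
    4 / (q * 2 ^ q) ≤ ∏ l ∈ Ico 1 q, |sin (π * l * β)| := by
  have hqR : (0 : ℝ) < q := by exact_mod_cast (by omega : 0 < q)
  have hq' : (0 : ℤ) < q := by exact_mod_cast (by omega : 0 < q)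
  refine (le_prod_sinLowerBound hq).trans ?_
  rw [← prod_Ico_mul_emod _ hpq]
  have hlt : ∀ l : ℕ, (l * p % q : ℤ).toNat < q := fun l => by
    have := Int.emod_lt_of_pos (l * p) hq'
    have := Int.emod_nonneg (l * p) hq'.ne'
    omega
  refine Finset.prod_le_prod (fun l _ => sinLowerBound_nonneg (hlt l)) fun l hl => ?_
  have hlq : (l : ℝ) + 1 ≤ q := by exact_mod_cast (Finset.mem_Ico.mp hl).2
  set j := (l * p % q : ℤ).toNat with hj
  set d := (l * p / q : ℤ) with hd
  have hdecomp : (l : ℝ) * p = q * d + j := by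
    have hjZ : (j : ℤ) = l * p % q := Int.toNat_of_nonneg (Int.emod_nonneg _ hq'.ne')
    have := Int.mul_ediv_add_emod (l * p) q
    rw [← hjZ] at this
    exact_mod_cast this.symm
  have hx : (l : ℝ) * β - d = j / q + l * (β - p / q) := by
    field_simp
    linear_combination hdecomp
  have hup : (l : ℝ) * (β - p / q) ≤ 1 / q - 1 / (q : ℝ) ^ 2 := by
    calc (l : ℝ) * (β - p / q) ≤ (q - 1) * (1 / (q : ℝ) ^ 2) :=
          mul_le_mul (by linarith) h1 h0 (by linarith [l.cast_nonneg (α := ℝ)])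
      _ = 1 / q - 1 / (q : ℝ) ^ 2 := by field_simp
  have hsin : |sin (π * l * β)| = |sin (π * (l * β - d))| := by
    rw [show π * (l * β - d) = π * l * β - d * π by ring, sin_sub_int_mul_pi, abs_mul]
    simp
  rw [hsin]
  refine (sinLowerBound_le (hlt l) hq ?_ ?_).trans (le_abs_self _)
  · rw [hx]
    exact le_add_of_nonneg_right (mul_nonneg l.cast_nonneg h0)
  · rw [hx, add_div]
    linarith

theorem le_prod_abs_sin {β : ℝ} {q : ℕ} {p : ℤ} (hq : 2 ≤ q) (hpq : IsCoprime p (q : ℤ))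
    (h : |β - p / q| ≤ 1 / (q : ℝ) ^ 2) :
    4 / (q * 2 ^ q) ≤ ∏ l ∈ Ico 1 q, |sin (π * l * β)| := by
  rcases le_total 0 (β - p / q) with h0 | h0
  · exact le_prod_abs_sin_of_nonneg hq hpq h0 ((le_abs_self _).trans h)
  · have hneg : -β - ((-p : ℤ) : ℝ) / q = -(β - p / q) := by
      push_cast
      ring
    have := le_prod_abs_sin_of_nonneg (β := -β) hq hpq.neg_left
      (hneg ▸ neg_nonneg.mpr h0) (hneg ▸ (neg_le_abs _).trans h)
    simpa only [mul_neg, sin_neg, abs_neg] using this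

theorem prod_inv_abs_sin_lt {β : ℝ} {q : ℕ} {p : ℤ} (hpq : IsCoprime p (q : ℤ))
    (h : |β - p / q| ≤ 1 / (q : ℝ) ^ 2) :
    ∏ l ∈ Ico 1 q, |sin (π * l * β)|⁻¹ < 2 * 3 ^ q := by
  rcases lt_or_ge q 2 with hq | hq
  · rw [Finset.Ico_eq_empty_of_le (by omega), Finset.prod_empty]
    have : (1 : ℝ) ≤ 3 ^ q := one_le_pow₀ (by norm_num)
    linarith
  have hqR : (0 : ℝ) < q := by exact_mod_cast (by omega : 0 < q)
  have hbern : 1 + (q : ℝ) * (1 / 2) ≤ (1 + 1 / 2 : ℝ) ^ q :=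
    one_add_mul_le_pow (by norm_num) q
  have h3 : (3 : ℝ) ^ q = (1 + 1 / 2) ^ q * 2 ^ q := by
    rw [← mul_pow]
    norm_num
  have h2 : (0 : ℝ) < 2 ^ q := by positivity
  rw [Finset.prod_inv_distrib]
  calc (∏ l ∈ Ico 1 q, |sin (π * l * β)|)⁻¹ ≤ (4 / (q * 2 ^ q) : ℝ)⁻¹ :=
        inv_anti₀ (by positivity) (le_prod_abs_sin hq hpq h)
    _ = q / 4 * 2 ^ q := by
        rw [inv_div]
        ring
    _ < 2 * 3 ^ q := by
        rw [h3, ← mul_assoc]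
        exact mul_lt_mul_of_pos_right (by linarith) h2

theorem irrational_contFracQuot {β : ℝ} (hirr : Irrational β) (n : ℕ) :
    Irrational (contFracQuot β n) := by
  induction n with
  | zero => exact hirr
  | succ n ih => exact (ih.sub_intCast ⌊contFracQuot β n⌋).inv

theorem one_lt_contFracQuot_succ {β : ℝ} (hirr : Irrational β) (n : ℕ) :
    1 < contFracQuot β (n + 1) := by
  have h0 : Int.fract (contFracQuot β n) ≠ 0 :=
    ((irrational_contFracQuot hirr n).sub_intCast ⌊contFracQuot β n⌋).ne_zero
  exact (one_lt_inv₀ ((Int.fract_nonneg _).lt_of_ne' h0)).mpr (Int.fract_lt_one _)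

theorem contFracQuot_mul_succ {β : ℝ} (hirr : Irrational β) (n : ℕ) :
    contFracQuot β n * contFracQuot β (n + 1) = contFracA β n * contFracQuot β (n + 1) + 1 := by
  have h0 : Int.fract (contFracQuot β n) ≠ 0 :=
    ((irrational_contFracQuot hirr n).sub_intCast ⌊contFracQuot β n⌋).ne_zero
  have h1 : Int.fract (contFracQuot β n) * contFracQuot β (n + 1) = 1 := mul_inv_cancel₀ h0
  rw [Int.fract] at h1
  rw [contFracA]
  linear_combination h1

theorem one_le_contFracA_succ {β : ℝ} (hirr : Irrational β) (n : ℕ) :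
    1 ≤ contFracA β (n + 1) :=
  Int.le_floor.mpr (by exact_mod_cast (one_lt_contFracQuot_succ hirr n).le)

theorem exists_contFrac_numerators {β : ℝ} (hirr : Irrational β) (n : ℕ) :
    ∃ P P' : ℤ, 0 < contFracQ β n ∧ 0 < contFracQ β (n + 1) ∧
      |P * contFracQ β n - P' * contFracQ β (n + 1)| = 1 ∧
      β * (contFracQuot β (n + 2) * contFracQ β (n + 1) + contFracQ β n)
        = contFracQuot β (n + 2) * P + P' := by
  induction n with
  | zero =>
    refine ⟨contFracA β 0 * contFracA β 1 + 1, contFracA β 0, ?_, ?_, ?_, ?_⟩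
    · simp [contFracQ]
    · exact one_le_contFracA_succ hirr 0
    · simp [contFracQ]
    · have h0 := contFracQuot_mul_succ hirr 0
      have h1 := contFracQuot_mul_succ hirr 1
      have hβ : contFracQuot β 0 = β := rfl
      rw [hβ] at h0
      simp only [contFracQ, zero_add] at h0 h1 ⊢
      push_cast
      linear_combination contFracQuot β 2 * h0 - (β - contFracA β 0) * h1
  | succ n ih =>
    obtain ⟨P, P', hQ, hQ1, hdet, hβ⟩ := ih
    have ha := one_le_contFracA_succ hirr (n + 1)
    have hrec : contFracQ β (n + 1 + 1)
        = contFracA β (n + 2) * contFracQ β (n + 1) + contFracQ β n := rfl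
    refine ⟨contFracA β (n + 2) * P + P', P, hQ1, ?_, ?_, ?_⟩
    · rw [hrec]
      have := mul_pos (zero_lt_one.trans_le ha) hQ1
      linarith
    · rw [hrec, ← hdet, ← abs_neg]
      congr 1
      ring
    · have h1 := contFracQuot_mul_succ hirr (n + 2)
      rw [hrec]
      push_cast
      linear_combination contFracQuot β (n + 3) * hβ - (β * contFracQ β (n + 1) - P) * h1

theorem exists_isCoprime_contFracQ {β : ℝ} (hirr : Irrational β) (n : ℕ) :
    0 < contFracQ β (n + 1) ∧ ∃ p : ℤ, IsCoprime p (contFracQ β (n + 1)) ∧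
      |β - p / contFracQ β (n + 1)| ≤ 1 / (contFracQ β (n + 1) : ℝ) ^ 2 := by
  obtain ⟨P, P', hQ, hQ1, hdet, hβ⟩ := exists_contFrac_numerators hirr n
  have hg := one_lt_contFracQuot_succ hirr (n + 1)
  set g := contFracQuot β (n + 2)
  set Q := contFracQ β n
  set Q1 := contFracQ β (n + 1)
  have hQR : (0 : ℝ) < Q := by exact_mod_cast hQ
  have hQ1R : (0 : ℝ) < Q1 := by exact_mod_cast hQ1
  refine ⟨hQ1, P, ?_, ?_⟩
  · rcases (abs_eq zero_le_one).mp hdet with h | h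
    · exact ⟨Q, -P', by linear_combination h⟩
    · exact ⟨-Q, P', by linear_combination -h⟩
  · have hD : (Q1 : ℝ) ≤ g * Q1 + Q := by nlinarith
    have hD0 : (0 : ℝ) < g * Q1 + Q := hQ1R.trans_le hD
    have hdetR : |(P : ℝ) * Q - P' * Q1| = 1 := by exact_mod_cast hdet
    have heq : β - P / Q1 = -(P * Q - P' * Q1) / (Q1 * (g * Q1 + Q)) := by
      field_simp
      linear_combination Q1 * hβ
    rw [heq, abs_div, abs_neg, hdetR, abs_of_pos (by positivity), sq]
    exact one_div_le_one_div_of_le (by positivity) (mul_le_mul_of_nonneg_left hD hQ1R.le)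

/-- For every positive irrational `β` there is a constant `C > 0` such that
for every `k ≥ 1`, `∏_{l=1}^{q_k - 1} 1/|sin (π l β)| < C * 3 ^ q_k`, where `q_k` is the
denominator of the `k`-th convergent of `β`. -/
theorem stmt2 (β : ℝ) (hirr : Irrational β) (hpos : 0 < β) :
    ∃ C : ℝ, 0 < C ∧ ∀ k : ℕ, 1 ≤ k →
      ∏ l ∈ Finset.Ico 1 (contFracQ β k).toNat, |Real.sin (π * l * β)|⁻¹
        < C * 3 ^ (contFracQ β k).toNat := by
  refine ⟨2, two_pos, fun k hk => ?_⟩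
  obtain ⟨n, rfl⟩ : ∃ n, k = n + 1 := ⟨k - 1, by omega⟩
  obtain ⟨hpos', p, hcop, happrox⟩ := exists_isCoprime_contFracQ hirr n
  lift contFracQ β (n + 1) to ℕ using hpos'.le with q
  exact prod_inv_abs_sin_lt hcop (by simpa using happrox)
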